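/- arXiv:1501.02708 — 3 statements merged into one kernel-verified Lean document; each statement's English description precedes it below -/
import Mathlib

section
/- Let d_A, d_B ≥ 2 and set m = (d_A − 1)·⌊d_B/2⌋. Every unitary U on the d_A × d_B system that is a controlled unitary from the A side can be written as U = L_0 G_1 L_1 G_2 ⋯ G_m L_m, where each L_i is a local unitary (of the form X ⊗ Y) and each G_i is a standard gate in computational position. -/
open Matrix Kronecker BigOperators

/-- A local unitary on the bipartite system: a Kronecker product of local unitaries. -/
def IsLocalUnitary {dA dB : ℕ} (L : Matrix (Fin dA × Fin dB) (Fin dA × Fin dB) ℂ) : Prop :=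
  ∃ (X : Matrix (Fin dA) (Fin dA) ℂ) (Y : Matrix (Fin dB) (Fin dB) ℂ),
    X ∈ Matrix.unitaryGroup (Fin dA) ℂ ∧ Y ∈ Matrix.unitaryGroup (Fin dB) ℂ ∧ L = X ⊗ₖ Y

/-- A standard gate in computational position: a unitary which fixes all computational
basis vectors outside a `2 × 2` sub-grid `{a₀,a₁} × {b₀,b₁}`, and whose restriction to
that sub-grid, as a matrix indexed by `Fin 2 × Fin 2`, has Schmidt rank at most 2. -/
def IsStdGate {dA dB : ℕ} (G : Matrix (Fin dA × Fin dB) (Fin dA × Fin dB) ℂ) : Prop :=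
  G ∈ Matrix.unitaryGroup (Fin dA × Fin dB) ℂ ∧
  ∃ (a : Fin 2 → Fin dA) (b : Fin 2 → Fin dB),
    Function.Injective a ∧ Function.Injective b ∧
    (∀ q : Fin dA × Fin dB, ((∀ i, q.1 ≠ a i) ∨ (∀ j, q.2 ≠ b j)) →
      ∀ p : Fin dA × Fin dB, G p q = if p = q then 1 else 0) ∧
    ∃ A₁ B₁ A₂ B₂ : Matrix (Fin 2) (Fin 2) ℂ,
      ∀ p q : Fin 2 × Fin 2,
        G (a p.1, b p.2) (a q.1, b q.2) = (A₁ ⊗ₖ B₁ + A₂ ⊗ₖ B₂) p q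

/-- `U` is controlled from the A side in the computational basis. -/
def CtrlAcb {dA dB : ℕ} (U : Matrix (Fin dA × Fin dB) (Fin dA × Fin dB) ℂ) : Prop :=
  ∀ p q : Fin dA × Fin dB, p.1 ≠ q.1 → U p q = 0

/-- `U` is a controlled unitary from the A side (up to local unitaries on the A factor). -/
def IsCtrlA {dA dB : ℕ} (U : Matrix (Fin dA × Fin dB) (Fin dA × Fin dB) ℂ) : Prop :=
  ∃ X Y : Matrix (Fin dA) (Fin dA) ℂ,
    X ∈ Matrix.unitaryGroup (Fin dA) ℂ ∧ Y ∈ Matrix.unitaryGroup (Fin dA) ℂ ∧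
    CtrlAcb ((X ⊗ₖ (1 : Matrix (Fin dB) (Fin dB) ℂ)) * U * (Y ⊗ₖ (1 : Matrix (Fin dB) (Fin dB) ℂ)))

/-- Every unitary matrix is unitarily diagonalizable. -/
theorem Matrix.exists_diagonal_of_mem_unitaryGroup {n : Type*} [Fintype n] [DecidableEq n]
    {V : Matrix n n ℂ} (hV : V ∈ unitaryGroup n ℂ) :
    ∃ W ∈ unitaryGroup n ℂ, ∃ d : n → ℂ, (∀ i, star (d i) * d i = 1) ∧
      V = W * diagonal d * star W := by
  -- The Cayley transform at a point `z` of the unit circle outside the spectrum is Hermitian.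
  have hinf : (Metric.sphere (0 : ℂ) 1).Infinite := by
    refine (isPreconnected_sphere (by simp) 0 1).infinite_of_nontrivial
      ⟨1, by simp, -1, by simp, ?_⟩
    norm_num [Complex.ext_iff]
  obtain ⟨z, hz, hzV⟩ := hinf.exists_notMem_finset V.charpoly.roots.toFinset
  have hz1 : star z * z = 1 := by
    have : ‖z‖ = 1 := by simpa using hz
    simp [Complex.conj_mul', this]
  have hS : IsUnit (z • (1 : Matrix n n ℂ) - V) := by
    rw [Matrix.isUnit_iff_isUnit_det, isUnit_iff_ne_zero]
    rw [Multiset.mem_toFinset, Polynomial.mem_roots V.charpoly_monic.ne_zero, Polynomial.IsRoot,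
      Matrix.eval_charpoly] at hzV
    rwa [smul_one_eq_diagonal]
  set S := z • (1 : Matrix n n ℂ) - V with hSdef
  obtain ⟨T, hT⟩ := hS.exists_left_inv
  have hVV : star V * V = 1 := (mem_unitaryGroup_iff').1 hV
  set H := Complex.I • ((z • (1 : Matrix n n ℂ) + V) * T) with hHdef
  have hHS : H * S = Complex.I • (z • (1 : Matrix n n ℂ) + V) := by
    rw [hHdef, smul_mul_assoc, mul_assoc, hT, mul_one]
  clear_value H
  have hSH : star S * star H = -Complex.I • (star z • (1 : Matrix n n ℂ) + star V) := by
    rw [← star_mul, hHS]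
    simp
  have hsS : star S = star z • (1 : Matrix n n ℂ) - star V := by simp [hSdef]
  have key : star S * (H - star H) * S = 0 := by
    rw [mul_sub (star S), sub_mul _ _ S, hSH, mul_assoc, hHS, hsS, hSdef]
    simp only [mul_add, add_mul, mul_sub, sub_mul, smul_mul_assoc, mul_smul_comm, one_mul, mul_one,
      hVV]
    match_scalars
    · linear_combination (2 * Complex.I) * hz1
    all_goals ring
  have hH : H.IsHermitian := by
    rw [hS.mul_left_eq_zero, hS.star.mul_right_eq_zero, sub_eq_zero] at key
    exact key.symm
  set W : Matrix n n ℂ := (hH.eigenvectorUnitary : Matrix n n ℂ)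
  have hW : W ∈ unitaryGroup n ℂ := hH.eigenvectorUnitary.2
  have hWW : star W * W = 1 := mem_unitaryGroup_iff'.1 hW
  have hWW' : W * star W = 1 := mem_unitaryGroup_iff.1 hW
  set e : n → ℂ := fun i => (hH.eigenvalues i : ℂ)
  have hHW : H = W * diagonal e * star W := by
    have := hH.spectral_theorem
    rw [Unitary.conjStarAlgAut_apply] at this
    exact this
  have he : ∀ i, e i + Complex.I ≠ 0 := fun i h => by
    simpa [e] using congrArg Complex.im h
  set d : n → ℂ := fun i => (e i + Complex.I)⁻¹ * (z * (e i - Complex.I))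
  have hVe : (diagonal e + Complex.I • 1) * (star W * V * W) =
      z • (diagonal e - Complex.I • 1) := by
    have h1 : H * V + Complex.I • V = z • (H - Complex.I • (1 : Matrix n n ℂ)) := by
      have := hHS
      rw [hSdef, mul_sub, smul_add, mul_smul_comm, mul_one, smul_smul] at this
      linear_combination (norm := module) (-1 : ℂ) • this
    have h2 : diagonal e = star W * H * W := by
      rw [hHW]
      simp only [mul_assoc, hWW, mul_one]
      rw [← mul_assoc, hWW, one_mul]
    have h3 := congrArg (fun M => star W * M * W) h1
    simp only [mul_add, add_mul, mul_sub, sub_mul, mul_smul_comm, smul_mul_assoc, mul_one,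
      hWW] at h3
    rw [h2, add_mul, smul_mul_assoc, one_mul, ← h3]
    simp only [mul_assoc]
    rw [← mul_assoc W (star W), hWW', one_mul]
  have hD : star W * V * W = diagonal d := by
    ext i j
    have := congrFun (congrFun hVe i) j
    rw [smul_one_eq_diagonal, diagonal_add, diagonal_mul, diagonal_sub, smul_apply] at this
    rw [← mul_right_inj' (he i), this, diagonal_apply, diagonal_apply]
    split_ifs
    · simp [d, mul_inv_cancel_left₀ (he i)]
    · simp
  refine ⟨W, hW, d, fun i => ?_, ?_⟩
  · have h : star (diagonal d) * diagonal d = 1 := by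
      rw [← hD]
      simp only [star_mul, star_star, mul_assoc]
      rw [← mul_assoc W (star W), hWW', one_mul, ← mul_assoc (star V), hVV, one_mul, hWW]
    have := congrFun (congrFun h i) i
    rw [star_eq_conjTranspose, diagonal_conjTranspose, diagonal_mul_diagonal] at this
    simpa using this
  · rw [← hD]
    simp only [mul_assoc]
    rw [hWW', mul_one, ← mul_assoc, hWW', one_mul]

section StandardCircuits

variable {dA dB : ℕ}

/-- `IsStdCircuit k U` says that `U` is a product of `k` standard gates interspersed with local
unitaries. -/
inductive IsStdCircuit : ℕ → Matrix (Fin dA × Fin dB) (Fin dA × Fin dB) ℂ → Prop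
  | of_local {L} : IsLocalUnitary L → IsStdCircuit 0 L
  | cons {k L G V} : IsLocalUnitary L → IsStdGate G → IsStdCircuit k V →
      IsStdCircuit (k + 1) (L * G * V)

theorem IsLocalUnitary.mul {L M : Matrix (Fin dA × Fin dB) (Fin dA × Fin dB) ℂ}
    (hL : IsLocalUnitary L) (hM : IsLocalUnitary M) : IsLocalUnitary (L * M) := by
  obtain ⟨X, Y, hX, hY, rfl⟩ := hL
  obtain ⟨X', Y', hX', hY', rfl⟩ := hM
  exact ⟨X * X', Y * Y', mul_mem hX hX', mul_mem hY hY', (mul_kronecker_mul ..).symm⟩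

theorem isLocalUnitary_kronecker_one {X : Matrix (Fin dA) (Fin dA) ℂ}
    (hX : X ∈ unitaryGroup (Fin dA) ℂ) :
    IsLocalUnitary (X ⊗ₖ (1 : Matrix (Fin dB) (Fin dB) ℂ)) :=
  ⟨X, 1, hX, one_mem _, rfl⟩

theorem isLocalUnitary_one_kronecker {Y : Matrix (Fin dB) (Fin dB) ℂ}
    (hY : Y ∈ unitaryGroup (Fin dB) ℂ) :
    IsLocalUnitary ((1 : Matrix (Fin dA) (Fin dA) ℂ) ⊗ₖ Y) :=
  ⟨1, Y, one_mem _, hY, rfl⟩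

theorem isLocalUnitary_one :
    IsLocalUnitary (1 : Matrix (Fin dA × Fin dB) (Fin dA × Fin dB) ℂ) :=
  ⟨1, 1, one_mem _, one_mem _, one_kronecker_one.symm⟩

namespace IsStdCircuit

variable {k l : ℕ} {U V L : Matrix (Fin dA × Fin dB) (Fin dA × Fin dB) ℂ}

theorem local_mul (hL : IsLocalUnitary L) (hV : IsStdCircuit k V) : IsStdCircuit k (L * V) := by
  cases hV with
  | of_local h => exact .of_local (hL.mul h)
  | cons h hG hV =>
    rw [← mul_assoc, ← mul_assoc]
    exact .cons (hL.mul h) hG hV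

theorem mul (hU : IsStdCircuit k U) (hV : IsStdCircuit l V) : IsStdCircuit (k + l) (U * V) := by
  induction hU with
  | of_local h => simpa using hV.local_mul h
  | cons h hG _ ih =>
    rw [mul_assoc, Nat.add_right_comm]
    exact .cons h hG ih

theorem mul_local (hV : IsStdCircuit k V) (hL : IsLocalUnitary L) : IsStdCircuit k (V * L) :=
  hV.mul (.of_local hL)

theorem exists_eq_prod (hU : IsStdCircuit k U) :
    ∃ (L : Fin (k + 1) → Matrix (Fin dA × Fin dB) (Fin dA × Fin dB) ℂ)
      (G : Fin k → Matrix (Fin dA × Fin dB) (Fin dA × Fin dB) ℂ),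
      (∀ i, IsLocalUnitary (L i)) ∧ (∀ i, IsStdGate (G i)) ∧
      U = L 0 * (List.ofFn (fun i => G i * L i.succ)).prod := by
  induction hU with
  | @of_local L h => exact ⟨fun _ => L, Fin.elim0, fun _ => h, fun i => i.elim0, by simp⟩
  | @cons k M G' V h hG _ ih =>
    obtain ⟨L, G, hL, hG', rfl⟩ := ih
    refine ⟨Fin.cons M L, Fin.cons G' G, Fin.cases h hL, Fin.cases hG hG', ?_⟩
    simp [List.ofFn_succ, mul_assoc]

end IsStdCircuit

/-- The controlled matrix `∑ j, |j⟩⟨j| ⊗ V j`. -/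
def ctrlMatrix (V : Fin dA → Matrix (Fin dB) (Fin dB) ℂ) :
    Matrix (Fin dA × Fin dB) (Fin dA × Fin dB) ℂ :=
  of fun p q => if p.1 = q.1 then V p.1 p.2 q.2 else 0

theorem ctrlMatrix_apply (V : Fin dA → Matrix (Fin dB) (Fin dB) ℂ) (p q : Fin dA × Fin dB) :
    ctrlMatrix V p q = if p.1 = q.1 then V p.1 p.2 q.2 else 0 := rfl

theorem ctrlMatrix_injective :
    Function.Injective (ctrlMatrix : (Fin dA → Matrix (Fin dB) (Fin dB) ℂ) → _) := by
  intro V W h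
  ext j a b
  simpa [ctrlMatrix_apply] using congrFun (congrFun h (j, a)) (j, b)

theorem ctrlMatrix_mul (V W : Fin dA → Matrix (Fin dB) (Fin dB) ℂ) :
    ctrlMatrix V * ctrlMatrix W = ctrlMatrix (V * W) := by
  ext p q
  simp only [Matrix.mul_apply, ctrlMatrix_apply, Fintype.sum_prod_type, Pi.mul_apply]
  rw [Finset.sum_eq_single p.1 (by simp +contextual [eq_comm]) (by simp)]
  by_cases h : p.1 = q.1 <;> simp [h]

theorem ctrlMatrix_const (B : Matrix (Fin dB) (Fin dB) ℂ) :
    ctrlMatrix (fun _ : Fin dA => B) = (1 : Matrix (Fin dA) (Fin dA) ℂ) ⊗ₖ B := by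
  ext p q
  simp [ctrlMatrix_apply, kroneckerMap_apply, one_apply]

theorem ctrlMatrix_one :
    ctrlMatrix (1 : Fin dA → Matrix (Fin dB) (Fin dB) ℂ) = 1 :=
  (ctrlMatrix_const 1).trans one_kronecker_one

theorem ctrlMatrix_smul_one (c : Fin dA → ℂ) :
    ctrlMatrix (fun j => c j • (1 : Matrix (Fin dB) (Fin dB) ℂ)) = diagonal c ⊗ₖ 1 := by
  ext p q
  simp [ctrlMatrix_apply, kroneckerMap_apply, diagonal_apply, ite_mul]

theorem star_ctrlMatrix (V : Fin dA → Matrix (Fin dB) (Fin dB) ℂ) :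
    star (ctrlMatrix V) = ctrlMatrix (star V) := by
  ext p q
  simp only [star_apply, ctrlMatrix_apply, Pi.star_apply]
  rcases eq_or_ne p.1 q.1 with h | h
  · simp [h]
  · simp [h, h.symm]

theorem ctrlMatrix_mem_unitaryGroup {V : Fin dA → Matrix (Fin dB) (Fin dB) ℂ} :
    ctrlMatrix V ∈ unitaryGroup (Fin dA × Fin dB) ℂ ↔ ∀ j, V j ∈ unitaryGroup (Fin dB) ℂ := by
  rw [mem_unitaryGroup_iff, star_ctrlMatrix, ctrlMatrix_mul, ← ctrlMatrix_one,
    ctrlMatrix_injective.eq_iff, funext_iff]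
  simp [mem_unitaryGroup_iff]

theorem CtrlAcb.eq_ctrlMatrix {U : Matrix (Fin dA × Fin dB) (Fin dA × Fin dB) ℂ}
    (hU : CtrlAcb U) : U = ctrlMatrix fun j => of fun a b => U (j, a) (j, b) := by
  ext p q
  rw [ctrlMatrix_apply]
  split_ifs with h
  · rw [of_apply, Prod.mk.eta, h, Prod.mk.eta]
  · exact hU p q h

theorem diagonal_mem_unitaryGroup {n : Type*} [Fintype n] [DecidableEq n] {d : n → ℂ}
    (hd : ∀ i, star (d i) * d i = 1) : diagonal d ∈ unitaryGroup n ℂ := by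
  rw [mem_unitaryGroup_iff', star_eq_conjTranspose, diagonal_conjTranspose, diagonal_mul_diagonal,
    ← diagonal_one]
  exact congrArg diagonal (funext hd)

theorem mulSingle_mem_unitaryGroup {V : Matrix (Fin dB) (Fin dB) ℂ}
    (hV : V ∈ unitaryGroup (Fin dB) ℂ) (j i : Fin dA) :
    (Pi.mulSingle j V : Fin dA → _) i ∈ unitaryGroup (Fin dB) ℂ := by
  rcases eq_or_ne i j with rfl | h
  · simpa
  · simp [h, one_mem]

/-- A controlled diagonal unitary that acts nontrivially on two levels only is a standard gate. -/
theorem isStdGate_ctrlMatrix_mulSingle_diagonal {i j : Fin dA} (hij : i ≠ j) {b c : Fin dB}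
    (hbc : b ≠ c) {d : Fin dB → ℂ} (hd : ∀ i, star (d i) * d i = 1)
    (hd1 : ∀ x, x ≠ b → x ≠ c → d x = 1) :
    IsStdGate (ctrlMatrix (Pi.mulSingle j (diagonal d))) := by
  refine ⟨ctrlMatrix_mem_unitaryGroup.2 <|
    mulSingle_mem_unitaryGroup (diagonal_mem_unitaryGroup hd) j, ![i, j], ![b, c], ?_, ?_, ?_,
    diagonal ![0, 1], diagonal ![d b, d c], diagonal ![1, 0], 1, ?_⟩
  · simpa [Function.Injective, Fin.forall_fin_two, eq_comm] using hij
  · simpa [Function.Injective, Fin.forall_fin_two, eq_comm] using hbc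
  · rintro ⟨q, y⟩ h ⟨p, x⟩
    simp only [Fin.forall_fin_two, cons_val_zero, cons_val_one, ne_eq] at h
    rw [ctrlMatrix_apply]
    rcases eq_or_ne p q with rfl | hpq
    · rcases eq_or_ne p j with rfl | hp
      · have hy : y ≠ b ∧ y ≠ c := by tauto
        rcases eq_or_ne x y with rfl | hxy
        · simp [hd1 x hy.1 hy.2]
        · simp [hxy]
      · simp [hp, one_apply]
    · simp [hpq]
  · simp [Prod.forall, Fin.forall_fin_two, ctrlMatrix_apply, kroneckerMap_apply, hij, hij.symm,
      hbc, hbc.symm]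

/-- A controlled diagonal unitary acting trivially beyond the first `2 * n` levels is a product
of `n` standard gates. -/
theorem isStdCircuit_ctrlMatrix_mulSingle_diagonal {i j : Fin dA} (hij : i ≠ j) {n : ℕ}
    (hn : 2 * n ≤ dB) {d : Fin dB → ℂ} (hd : ∀ i, star (d i) * d i = 1)
    (hd1 : ∀ x : Fin dB, 2 * n ≤ x → d x = 1) :
    IsStdCircuit n (ctrlMatrix (Pi.mulSingle j (diagonal d))) := by
  induction n generalizing d with
  | zero =>
    obtain rfl : d = fun _ => 1 := funext fun x => hd1 x (by simp)
    rw [diagonal_one, Pi.mulSingle_one, ctrlMatrix_one]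
    exact .of_local isLocalUnitary_one
  | succ n ih =>
    have h := ih (d := fun x => if 2 * n ≤ x then 1 else d x) (by omega)
      (fun x => by split_ifs <;> first | exact hd x | simp) (fun x hx => by simp [hx])
    have hG := isStdGate_ctrlMatrix_mulSingle_diagonal hij
      (b := ⟨2 * n, by omega⟩) (c := ⟨2 * n + 1, by omega⟩) (by simp)
      (d := fun x => if 2 * n ≤ x then d x else 1)
      (fun x => by split_ifs <;> first | exact hd x | simp) (fun x hb hc => by
        simp only [ne_eq, Fin.ext_iff] at hb hc
        split_ifs
        · exact hd1 x (by omega)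
        · rfl)
    convert IsStdCircuit.cons isLocalUnitary_one hG h using 1
    rw [one_mul, ctrlMatrix_mul, ← Pi.mulSingle_mul, diagonal_mul_diagonal]
    congr 3
    ext x
    split_ifs <;> simp

/-- A unitary on the B side controlled by a single level of the A side is a product of
`dB / 2` standard gates. -/
theorem isStdCircuit_ctrlMatrix_mulSingle {i j : Fin dA} (hij : i ≠ j) (hdB : 0 < dB)
    {V : Matrix (Fin dB) (Fin dB) ℂ} (hV : V ∈ unitaryGroup (Fin dB) ℂ) :
    IsStdCircuit (dB / 2) (ctrlMatrix (Pi.mulSingle j V)) := by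
  obtain ⟨W, hW, d, hd, rfl⟩ := exists_diagonal_of_mem_unitaryGroup hV
  set c := d ⟨dB - 1, by omega⟩
  have hcc : star c * c = 1 := hd _
  have hcc' : c * star c = 1 := by rw [mul_comm, hcc]
  have h := isStdCircuit_ctrlMatrix_mulSingle_diagonal hij (n := dB / 2) (by omega)
    (d := fun x => star c * d x) (fun x => by
      rw [star_mul, star_star, mul_assoc, ← mul_assoc c, hcc', one_mul, hd])
    (fun x hx => by
      rw [show x = ⟨dB - 1, by omega⟩ from Fin.ext (by simp only; omega)]
      exact hcc)
  have hphase : IsLocalUnitary (dA := dA) (dB := dB) (diagonal (Pi.mulSingle j c) ⊗ₖ 1) :=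
    isLocalUnitary_kronecker_one <| diagonal_mem_unitaryGroup fun k => by
      rcases eq_or_ne k j with rfl | hk
      · simpa using hcc
      · simp [hk]
  convert ((h.local_mul hphase).local_mul (isLocalUnitary_one_kronecker hW)).mul_local
    (isLocalUnitary_one_kronecker (Unitary.star_mem hW)) using 1
  rw [← ctrlMatrix_smul_one, ← ctrlMatrix_const, ← ctrlMatrix_const, ctrlMatrix_mul,
    ctrlMatrix_mul, ctrlMatrix_mul]
  congr 1
  funext k
  rcases eq_or_ne k j with rfl | hk
  · simp only [Pi.mul_apply, Pi.mulSingle_eq_same, smul_mul_assoc, one_mul]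
    congr 2
    ext x y
    simp only [Matrix.smul_apply, diagonal_apply, smul_eq_mul]
    split_ifs
    · rw [← mul_assoc, hcc', one_mul]
    · simp
  · simp [hk, mem_unitaryGroup_iff.1 hW]

/-- A controlled unitary is a product of `dB / 2` standard gates for each level of the A side
on which it is nontrivial. -/
theorem isStdCircuit_ctrlMatrix_of_eq_one (hdB : 0 < dB) (i : Fin dA) (s : Finset (Fin dA))
    (hi : i ∉ s) {V : Fin dA → Matrix (Fin dB) (Fin dB) ℂ}
    (hV : ∀ j, V j ∈ unitaryGroup (Fin dB) ℂ) (hVs : ∀ j ∉ s, V j = 1) :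
    IsStdCircuit (s.card * (dB / 2)) (ctrlMatrix V) := by
  induction s using Finset.induction_on generalizing V with
  | empty =>
    obtain rfl : V = 1 := funext fun j => hVs j (by simp)
    rw [ctrlMatrix_one, Finset.card_empty, zero_mul]
    exact .of_local isLocalUnitary_one
  | insert j s hj ih =>
    rw [Finset.mem_insert, not_or] at hi
    have h := ih (V := Function.update V j 1) hi.2
      (fun k => by rcases eq_or_ne k j with rfl | hk <;> simp [*, one_mem])
      (fun k hk => by rcases eq_or_ne k j with rfl | hkj <;> simp [*])
    rw [Finset.card_insert_of_notMem hj, add_mul, one_mul]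
    convert h.mul (isStdCircuit_ctrlMatrix_mulSingle hi.1 hdB (hV j)) using 1
    rw [ctrlMatrix_mul]
    congr 1
    funext k
    rcases eq_or_ne k j with rfl | hk <;> simp [*]

theorem isStdCircuit_ctrlMatrix (hdA : 0 < dA) (hdB : 0 < dB)
    {V : Fin dA → Matrix (Fin dB) (Fin dB) ℂ} (hV : ∀ j, V j ∈ unitaryGroup (Fin dB) ℂ) :
    IsStdCircuit ((dA - 1) * (dB / 2)) (ctrlMatrix V) := by
  let i : Fin dA := ⟨0, hdA⟩
  have h := isStdCircuit_ctrlMatrix_of_eq_one hdB i (Finset.univ.erase i) (by simp)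
    (V := fun j => star (V i) * V j) (fun j => mul_mem (Unitary.star_mem (hV i)) (hV j))
    (fun j hj => by
      obtain rfl : j = i := by simpa using hj
      exact mem_unitaryGroup_iff'.1 (hV i))
  rw [Finset.card_erase_of_mem (Finset.mem_univ i), Finset.card_univ, Fintype.card_fin] at h
  convert h.local_mul (isLocalUnitary_one_kronecker (hV i)) using 1
  rw [← ctrlMatrix_const, ctrlMatrix_mul]
  congr 1
  funext j
  rw [Pi.mul_apply, ← mul_assoc, mem_unitaryGroup_iff.1 (hV i), one_mul]

theorem IsLocalUnitary.mem_unitaryGroup {L : Matrix (Fin dA × Fin dB) (Fin dA × Fin dB) ℂ}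
    (hL : IsLocalUnitary L) : L ∈ unitaryGroup (Fin dA × Fin dB) ℂ := by
  obtain ⟨X, Y, hX, hY, rfl⟩ := hL
  exact kronecker_mem_unitary hX hY

end StandardCircuits

/-- Every controlled unitary from the A side on the `d_A × d_B` system is the product of
`(d_A − 1) ⌊d_B/2⌋` standard gates interspersed with local unitaries. -/
theorem ctrlA_std_gates (dA dB : ℕ) (hdA : 2 ≤ dA) (hdB : 2 ≤ dB)
    (U : Matrix (Fin dA × Fin dB) (Fin dA × Fin dB) ℂ)
    (hU : U ∈ Matrix.unitaryGroup (Fin dA × Fin dB) ℂ) (hC : IsCtrlA U) :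
    ∃ (L : Fin ((dA - 1) * (dB / 2) + 1) → Matrix (Fin dA × Fin dB) (Fin dA × Fin dB) ℂ)
      (G : Fin ((dA - 1) * (dB / 2)) → Matrix (Fin dA × Fin dB) (Fin dA × Fin dB) ℂ),
      (∀ i, IsLocalUnitary (L i)) ∧ (∀ i, IsStdGate (G i)) ∧
      U = L 0 * (List.ofFn (fun i => G i * L i.succ)).prod := by
  obtain ⟨X, Y, hX, hY, hC⟩ := hC
  have hX' := isLocalUnitary_kronecker_one (dB := dB) hX
  have hY' := isLocalUnitary_kronecker_one (dB := dB) hY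
  have hUc := mul_mem (mul_mem hX'.mem_unitaryGroup hU) hY'.mem_unitaryGroup
  rw [hC.eq_ctrlMatrix, ctrlMatrix_mem_unitaryGroup] at hUc
  have h := isStdCircuit_ctrlMatrix (by omega) (by omega) hUc
  rw [← hC.eq_ctrlMatrix] at h
  refine IsStdCircuit.exists_eq_prod ?_
  convert (h.local_mul (isLocalUnitary_kronecker_one (Unitary.star_mem hX))).mul_local
    (isLocalUnitary_kronecker_one (Unitary.star_mem hY)) using 1
  simp only [mul_assoc]
  rw [← mul_kronecker_mul, mem_unitaryGroup_iff.1 hY, one_mul, one_kronecker_one, mul_one,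
    ← mul_assoc, ← mul_kronecker_mul, mem_unitaryGroup_iff'.1 hX, one_mul, one_kronecker_one,
    one_mul]
end

section
/- Let d_A, d_B ≥ 1. Every permutation π of Fin d_A × Fin d_B is the composition of a finite sequence of permutations in which at most 3·(d_A − 1)·(d_B − 1) members are row/column transpositions (each such member is a transposition swapping two pairs that agree in the first coordinate, i.e., swap (a,b) (a,b') with b ≠ b', or two pairs that agree in the second coordinate, i.e., swap (a,b) (a',b) with a ≠ a'), and every other member of the sequence is a local permutation of the form (a,b) ↦ (ρ(a), b) or (a,b) ↦ (a, τ(b)) for permutations ρ of Fin d_A and τ of Fin d_B. -/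
/-- A row/column transposition: a transposition of two pairs agreeing in the first
coordinate, or of two pairs agreeing in the second coordinate. -/
def IsRCTransposition {dA dB : ℕ} (σ : Equiv.Perm (Fin dA × Fin dB)) : Prop :=
  (∃ (a : Fin dA) (b b' : Fin dB), b ≠ b' ∧ σ = Equiv.swap (a, b) (a, b')) ∨
  (∃ (a a' : Fin dA) (b : Fin dB), a ≠ a' ∧ σ = Equiv.swap (a, b) (a', b))

/-- A local permutation: one acting only on the first or only on the second factor. -/
def IsLocalPerm {dA dB : ℕ} (σ : Equiv.Perm (Fin dA × Fin dB)) : Prop :=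
  (∃ ρ : Equiv.Perm (Fin dA), ∀ a b, σ (a, b) = (ρ a, b)) ∨
  (∃ τ : Equiv.Perm (Fin dB), ∀ a b, σ (a, b) = (a, τ b))

open Finset in
/-- Every `n`-regular bipartite multigraph, given by its edges `E` with end points `s` and `t`, is
properly edge-colourable with `n` colours. -/
theorem exists_edge_coloring {ι α : Type*} [DecidableEq ι] [Fintype α] [DecidableEq α]
    (s t : ι → α) (n : ℕ) (E : Finset ι) (hs : ∀ a, #{e ∈ E | s e = a} = n)
    (ht : ∀ a, #{e ∈ E | t e = a} = n) :
    ∃ c : ι → ℕ, (∀ e ∈ E, c e < n) ∧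
      ∀ e ∈ E, ∀ e' ∈ E, c e = c e' → (s e = s e' ∨ t e = t e') → e = e' := by
  induction n generalizing E with
  | zero =>
    have hE : ∀ e, e ∉ E := fun e he => by
      have := hs (s e)
      rw [card_eq_zero] at this
      exact notMem_empty e (this ▸ mem_filter.2 ⟨he, rfl⟩)
    exact ⟨fun _ => 0, fun e he => (hE e he).elim, fun e he => (hE e he).elim⟩
  | succ n ih =>
    have hall : ∀ S : Finset α, #S ≤ #(S.biUnion fun a => {e ∈ E | s e = a}.image t) := by
      intro S
      have hu : ∀ (u : ι → α) (_ : ∀ a, #{e ∈ E | u e = a} = n + 1) (U : Finset α),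
          #{e ∈ E | u e ∈ U} = #U * (n + 1) := fun u hu U => by
        simp [← sum_card_fiberwise_eq_card_filter, hu]
      refine Nat.le_of_mul_le_mul_right (c := n + 1) ?_ n.succ_pos
      rw [← hu s hs, ← hu t ht]
      refine card_le_card fun e he => ?_
      obtain ⟨heE, heS⟩ := mem_filter.1 he
      exact mem_filter.2 ⟨heE, mem_biUnion.2
        ⟨s e, heS, mem_image_of_mem t (mem_filter.2 ⟨heE, rfl⟩)⟩⟩
    obtain ⟨f, hf, hfm⟩ := (all_card_le_biUnion_card_iff_exists_injective _).1 hall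
    have : ∀ a, ∃ e ∈ E, s e = a ∧ t e = f a := by
      intro a
      have := hfm a
      simp only [mem_image, mem_filter] at this
      grind
    choose m hmE hms hmt using this
    have hfs : Function.Surjective f := Finite.surjective_of_injective hf
    have hM : ∀ (u : ι → α) (_ : ∀ a, #{e ∈ E | u e = a} = n + 1)
        (_ : ∀ a, ∃! b, u (m b) = a) (a : α),
        #{e ∈ E \ univ.image m | u e = a} = n := by
      intro u hu hum a
      obtain ⟨b, hb, hb'⟩ := hum a
      have : {e ∈ E \ univ.image m | u e = a} = {e ∈ E | u e = a}.erase (m b) := by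
        ext e
        simp only [mem_filter, mem_sdiff, mem_image, mem_univ, true_and, mem_erase]
        grind
      rw [this, card_erase_of_mem (by simp [hmE, hb]), hu, Nat.add_sub_cancel]
    obtain ⟨c, hc, hcc⟩ := ih (E \ univ.image m)
      (hM s hs fun a => ⟨a, hms a, fun b hb => by rw [← hb, hms]⟩)
      (hM t ht fun a => by
        obtain ⟨b, rfl⟩ := hfs a
        exact ⟨b, hmt b, fun b' hb' => hf (by rw [← hmt b', hb'])⟩)
    refine ⟨fun e => if e ∈ univ.image m then n else c e, fun e he => ?_, fun e he e' he' h h' => ?_⟩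
    · by_cases hem : e ∈ univ.image m
      · simp [hem]
      · simp only [hem, if_false]
        exact (hc e (mem_sdiff.2 ⟨he, hem⟩)).trans n.lt_succ_self
    · by_cases hem : e ∈ univ.image m <;> by_cases hem' : e' ∈ univ.image m <;>
        simp only [hem, hem', if_true, if_false] at h
      · simp only [mem_image, mem_univ, true_and] at hem hem'
        obtain ⟨a, rfl⟩ := hem
        obtain ⟨a', rfl⟩ := hem'
        rw [hms, hms, hmt, hmt] at h'
        exact congrArg m (h'.elim id fun h => hf h)
      · exact absurd (hc e' (mem_sdiff.2 ⟨he', hem'⟩)) h.not_gt.elim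
      · exact absurd (hc e (mem_sdiff.2 ⟨he, hem⟩)) h.symm.not_gt.elim
      · exact hcc e (mem_sdiff.2 ⟨he, hem⟩) e' (mem_sdiff.2 ⟨he', hem'⟩) h h'

/-- Every permutation of a grid permutes within rows, then within columns, then within rows. -/
theorem exists_row_column_row {α : Type*} [Fintype α] [DecidableEq α] {n : ℕ}
    (π : Equiv.Perm (α × Fin n)) :
    ∃ h v h' : Equiv.Perm (α × Fin n), π = h * v * h' ∧
      (∀ x, (h x).1 = x.1) ∧ (∀ x, (v x).2 = x.2) ∧ ∀ x, (h' x).1 = x.1 := by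
  have hcard : ∀ a : α, (Finset.univ.filter fun x : α × Fin n => x.1 = a).card = n := by
    intro a
    have : (Finset.univ.filter fun x : α × Fin n => x.1 = a) = {a} ×ˢ Finset.univ := by
      ext ⟨b, c⟩
      simp [eq_comm]
    rw [this]
    simp
  obtain ⟨c, hc, hcc⟩ := exists_edge_coloring (fun x : α × Fin n => x.1) (fun x => (π x).1) n
    Finset.univ hcard (fun a => by
      exact (Finset.card_equiv π (by simp)).trans (hcard a))
  simp only [Finset.mem_univ, true_implies] at hc hcc
  let f : α × Fin n → α × Fin n := fun x => (x.1, ⟨c x, hc x⟩)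
  let g : α × Fin n → α × Fin n := fun x => ((π x).1, ⟨c x, hc x⟩)
  have hf : f.Bijective := Finite.injective_iff_bijective.1 fun x y h => by
    simp only [f, Prod.mk.injEq, Fin.mk.injEq] at h
    exact hcc x y h.2 (Or.inl h.1)
  have hg : g.Bijective := Finite.injective_iff_bijective.1 fun x y h => by
    simp only [g, Prod.mk.injEq, Fin.mk.injEq] at h
    exact hcc x y h.2 (Or.inr h.1)
  refine ⟨π * (Equiv.ofBijective g hg)⁻¹, Equiv.ofBijective g hg * (Equiv.ofBijective f hf)⁻¹,
    Equiv.ofBijective f hf, by group, fun x => ?_, fun x => ?_, fun x => rfl⟩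
  · obtain ⟨y, rfl⟩ := (Equiv.ofBijective g hg).surjective x
    simp [g]
  · obtain ⟨y, rfl⟩ := (Equiv.ofBijective f hf).surjective x
    simp [f, g]

/-- `RCDecomp n σ` means that `σ` is a product of local permutations and at most `n` row/column
transpositions. -/
inductive RCDecomp {dA dB : ℕ} : ℕ → Equiv.Perm (Fin dA × Fin dB) → Prop
  | one (n : ℕ) : RCDecomp n 1
  | local_mul {n : ℕ} {σ τ} : IsLocalPerm σ → RCDecomp n τ → RCDecomp n (σ * τ)
  | transposition_mul {n : ℕ} {σ τ} : IsRCTransposition σ → RCDecomp n τ → RCDecomp (n + 1) (σ * τ)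

namespace RCDecomp

variable {dA dB : ℕ}

theorem mono {m n : ℕ} {σ : Equiv.Perm (Fin dA × Fin dB)} (h : RCDecomp m σ) (hmn : m ≤ n) :
    RCDecomp n σ := by
  induction h generalizing n with
  | one => exact one n
  | local_mul hσ _ ih => exact local_mul hσ (ih hmn)
  | transposition_mul hσ _ ih =>
    obtain ⟨k, rfl⟩ := Nat.exists_eq_add_of_le' (Nat.le_of_add_left_le hmn)
    exact transposition_mul hσ (ih (by omega))

theorem mul {m n : ℕ} {σ τ : Equiv.Perm (Fin dA × Fin dB)} (hσ : RCDecomp m σ)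
    (hτ : RCDecomp n τ) : RCDecomp (m + n) (σ * τ) := by
  induction hσ with
  | one m => simpa using hτ.mono (Nat.le_add_left n m)
  | local_mul h _ ih => rw [mul_assoc]; exact local_mul h ih
  | transposition_mul h _ ih =>
    rw [mul_assoc, Nat.add_right_comm]
    exact transposition_mul h ih

theorem prodComm {n : ℕ} {σ : Equiv.Perm (Fin dA × Fin dB)} (h : RCDecomp n σ) :
    RCDecomp n ((Equiv.prodComm _ _).permCongr σ) := by
  induction h with
  | one n =>
    convert one n
    ext x <;> simp
  | @local_mul n σ τ hσ _ ih =>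
    have : (Equiv.prodComm _ _).permCongr (σ * τ) =
      (Equiv.prodComm _ _).permCongr σ * (Equiv.prodComm _ _).permCongr τ := by
        ext x <;> simp
    rw [this]
    refine local_mul ?_ ih
    rcases hσ with ⟨ρ, h⟩ | ⟨ρ, h⟩
    · exact Or.inr ⟨ρ, fun a b => by simp [h]⟩
    · exact Or.inl ⟨ρ, fun a b => by simp [h]⟩
  | @transposition_mul n σ τ hσ _ ih =>
    have : (Equiv.prodComm _ _).permCongr (σ * τ) =
      (Equiv.prodComm _ _).permCongr σ * (Equiv.prodComm _ _).permCongr τ := by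
        ext x <;> simp
    rw [this]
    refine transposition_mul ?_ ih
    rcases hσ with ⟨a, b, b', h, rfl⟩ | ⟨a, a', b, h, rfl⟩
    · exact Or.inr ⟨b, b', a, h, Equiv.symm_trans_swap_trans _ _ _⟩
    · exact Or.inl ⟨b, a, a', h, Equiv.symm_trans_swap_trans _ _ _⟩

theorem prodExtendRight (a : Fin dA) (k : ℕ) (e : Equiv.Perm (Fin dB))
    (he : e.support.card ≤ k + 1) : RCDecomp k (Equiv.Perm.prodExtendRight a e) := by
  have h_one : Equiv.Perm.prodExtendRight a (1 : Equiv.Perm (Fin dB)) = 1 := by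
    ext1 ⟨a', b⟩
    by_cases h : a' = a <;> simp [Equiv.Perm.prodExtendRight, h]
  induction k generalizing e with
  | zero =>
    rw [Equiv.Perm.card_support_le_one.1 he, h_one]
    exact one 0
  | succ k ih =>
    by_cases h1 : e = 1
    · rw [h1, h_one]
      exact one _
    · obtain ⟨x, hx⟩ : ∃ x, e x ≠ x := by
        by_contra! h
        exact h1 (Equiv.ext h)
      have hlt := Equiv.Perm.card_support_swap_mul hx
      have : Equiv.Perm.prodExtendRight a e = Equiv.swap (a, x) (a, e x) *
          Equiv.Perm.prodExtendRight a (Equiv.swap x (e x) * e) := by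
        ext1 ⟨a', b⟩
        by_cases h : a' = a
        · subst h
          simp only [Equiv.Perm.coe_mul, Function.comp_apply, Equiv.Perm.prodExtendRight_apply_eq]
          rw [(Prod.mk_right_injective a').swap_apply, Equiv.swap_apply_self]
        · simp only [Equiv.Perm.coe_mul, Function.comp_apply,
            Equiv.Perm.prodExtendRight_apply_ne _ h]
          exact (Equiv.swap_apply_of_ne_of_ne (by simp [h]) (by simp [h])).symm
      rw [this]
      exact transposition_mul (Or.inl ⟨a, x, e x, hx.symm, rfl⟩) (ih _ (by omega))

theorem prodCongrRight (S : Finset (Fin dA)) (τ : Fin dA → Equiv.Perm (Fin dB))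
    (hτ : ∀ a ∉ S, τ a = 1) :
    RCDecomp (S.card * (dB - 1)) (Equiv.prodCongrRight τ) := by
  induction S using Finset.induction_on generalizing τ with
  | empty =>
    have : Equiv.prodCongrRight τ = (1 : Equiv.Perm (Fin dA × Fin dB)) := by
      ext1 ⟨a, b⟩
      simp [hτ a (Finset.notMem_empty a)]
    rw [this]
    exact one _
  | insert a S ha ih =>
    have : Equiv.prodCongrRight τ = Equiv.Perm.prodExtendRight a (τ a) *
        Equiv.prodCongrRight (Function.update τ a 1) := by
      ext1 ⟨a', b⟩
      by_cases h : a' = a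
      · subst h
        simp [Equiv.Perm.prodExtendRight_apply_eq]
      · simp [Equiv.Perm.prodExtendRight_apply_ne _ h, h]
    rw [this, Finset.card_insert_of_notMem ha, Nat.add_mul, one_mul, Nat.add_comm]
    refine mul (prodExtendRight a _ _ ?_) (ih _ fun a' ha' => ?_)
    · have := (τ a).support.card_le_univ
      rw [Fintype.card_fin] at this
      omega
    · by_cases h : a' = a
      · simp [h]
      · simp [h, hτ a' (by simp [h, ha'])]

theorem of_fst_eq (hdA : 1 ≤ dA) (σ : Equiv.Perm (Fin dA × Fin dB)) (h : ∀ x, (σ x).1 = x.1) :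
    RCDecomp ((dA - 1) * (dB - 1)) σ := by
  have hbij : ∀ a, Function.Bijective fun b => (σ (a, b)).2 := fun a =>
    Finite.injective_iff_bijective.1 fun b b' hb => by
      have : σ (a, b) = σ (a, b') := Prod.ext (by rw [h, h]) hb
      simpa using this
  let τ : Fin dA → Equiv.Perm (Fin dB) := fun a => Equiv.ofBijective _ (hbij a)
  let z : Fin dA := ⟨0, hdA⟩
  have : σ = Equiv.prodCongrRight (fun _ => τ z) * Equiv.prodCongrRight fun a => (τ z)⁻¹ * τ a := by
    ext1 ⟨a, b⟩
    refine Prod.ext (by simp [h]) ?_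
    simp [τ]
  rw [this]
  refine local_mul (Or.inr ⟨τ z, fun _ _ => rfl⟩) ?_
  have := prodCongrRight (Finset.univ.erase z) (fun a => (τ z)⁻¹ * τ a) fun a ha => by
    have : a = z := by simpa using ha
    simp [this]
  simpa using this

theorem of_snd_eq (hdB : 1 ≤ dB) (σ : Equiv.Perm (Fin dA × Fin dB)) (h : ∀ x, (σ x).2 = x.2) :
    RCDecomp ((dA - 1) * (dB - 1)) σ := by
  have := (of_fst_eq hdB ((Equiv.prodComm _ _).permCongr σ) fun x => by simp [h]).prodComm
  rw [Nat.mul_comm]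
  convert this
  ext x <;> simp

theorem exists_list {n : ℕ} {σ : Equiv.Perm (Fin dA × Fin dB)} (h : RCDecomp n σ) :
    ∃ (k : ℕ) (f : Fin k → Equiv.Perm (Fin dA × Fin dB)) (T : Finset (Fin k)),
      T.card ≤ n ∧ (∀ i ∈ T, IsRCTransposition (f i)) ∧ (∀ i ∉ T, IsLocalPerm (f i)) ∧
      σ = (List.ofFn f).prod := by
  induction h with
  | one n => exact ⟨0, Fin.elim0, ∅, by simp, by simp, fun i => i.elim0, by simp⟩
  | @local_mul n σ τ hσ _ ih =>
    obtain ⟨k, f, T, hT, h1, h2, rfl⟩ := ih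
    refine ⟨k + 1, Fin.cons σ f, T.map (Fin.succEmb k), by simpa using hT, ?_, ?_, by simp⟩
    · simpa using h1
    · intro i
      cases i using Fin.cases with
      | zero => exact fun _ => hσ
      | succ i => simpa using h2 i
  | @transposition_mul n σ τ hσ _ ih =>
    obtain ⟨k, f, T, hT, h1, h2, rfl⟩ := ih
    refine ⟨k + 1, Fin.cons σ f, insert 0 (T.map (Fin.succEmb k)),
      (Finset.card_insert_le _ _).trans (by simpa using hT), ?_, ?_, by simp⟩
    · simpa [hσ] using h1
    · intro i
      cases i using Fin.cases with
      | zero => simp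
      | succ i => simpa using h2 i

end RCDecomp

/-- Every permutation of `Fin d_A × Fin d_B` is the composition of a finite sequence of
permutations in which at most `3 (d_A − 1)(d_B − 1)` members are row/column transpositions
and all other members are local permutations. -/
theorem perm_decomp_transpositions (dA dB : ℕ) (hdA : 1 ≤ dA) (hdB : 1 ≤ dB)
    (π : Equiv.Perm (Fin dA × Fin dB)) :
    ∃ (k : ℕ) (f : Fin k → Equiv.Perm (Fin dA × Fin dB)) (T : Finset (Fin k)),
      T.card ≤ 3 * (dA - 1) * (dB - 1) ∧
      (∀ i ∈ T, IsRCTransposition (f i)) ∧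
      (∀ i ∉ T, IsLocalPerm (f i)) ∧
      π = (List.ofFn f).prod := by
  obtain ⟨h, v, h', rfl, hh, hv, hh'⟩ := exists_row_column_row π
  have := ((RCDecomp.of_fst_eq hdA h hh).mul (RCDecomp.of_snd_eq hdB v hv)).mul
    (RCDecomp.of_fst_eq hdA h' hh')
  exact (this.mono (by linarith)).exists_list
end

section
/- Let U be a permutation matrix indexed by Fin d_A × Fin d_B (d_A, d_B ≥ 1), and suppose U = ∑_{i=1}^r A_i ⊗ B_i for some r ≥ 1, complex d_A × d_A matrices A_i and complex d_B × d_B matrices B_i. Then there exist q ≤ min{d_A², d_B², d_A·r, d_B·r, 2^r}, partial permutation d_A × d_A matrices A'_1, …, A'_q and partial permutation d_B × d_B matrices B'_1, …, B'_q such that U = ∑_{j=1}^q A'_j ⊗ B'_j; that is, the partial-permutation rank of U is at most min{d_A², d_B², d_A·r, d_B·r, 2^r}. -/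
open Matrix Kronecker BigOperators

/-- A permutation matrix: a 0–1 matrix with exactly one 1 in each row and each column. -/
def IsPermMatrix {n : Type*} (M : Matrix n n ℂ) : Prop :=
  (∀ i j, M i j = 0 ∨ M i j = 1) ∧ (∀ i, ∃! j, M i j = 1) ∧ (∀ j, ∃! i, M i j = 1)

/-- A partial permutation matrix: a 0–1 matrix with at most one 1 in each row and
each column. -/
def IsPartialPermMatrix {n : Type*} (M : Matrix n n ℂ) : Prop :=
  (∀ i j, M i j = 0 ∨ M i j = 1) ∧
  (∀ i j j', M i j = 1 → M i j' = 1 → j = j') ∧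
  (∀ i i' j, M i j = 1 → M i' j = 1 → i = i')

/-- A family of `0`–`1` vectors whose matrix factors through dimension `r` takes at most `2 ^ r`
distinct values. -/
theorem card_image_le_two_pow_of_zero_one {ι κ : Type*} [Fintype ι] [DecidableEq (κ → ℂ)] {r : ℕ}
    (a : ι → Fin r → ℂ) (b : κ → Fin r → ℂ)
    (h01 : ∀ i x, a i ⬝ᵥ b x = 0 ∨ a i ⬝ᵥ b x = 1) :
    (Finset.univ.image fun i x => a i ⬝ᵥ b x).card ≤ 2 ^ r := by
  classical
  obtain ⟨s, hsub, hspan, hli⟩ := exists_linearIndependent ℂ (Set.range b)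
  have : Fintype s := hli.setFinite.fintype
  have hs : Fintype.card s ≤ r := by
    simpa using hli.fintype_card_le_finrank
  have hsb : ∀ v : s, ∃ x, b x = v := fun v => hsub v.2
  choose x hx using hsb
  have hdet : ∀ i j, (∀ v : s, a i ⬝ᵥ v = a j ⬝ᵥ v) → ∀ y, a i ⬝ᵥ b y = a j ⬝ᵥ b y := by
    intro i j hij y
    have hy : b y ∈ Submodule.span ℂ s := hspan ▸ Submodule.subset_span ⟨y, rfl⟩
    generalize b y = w at hy ⊢
    induction hy using Submodule.span_induction with
    | mem v hv => exact hij ⟨v, hv⟩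
    | zero => simp
    | add v w _ _ hv hw => simp [dotProduct_add, hv, hw]
    | smul c v _ hv => simp [dotProduct_smul, hv]
  have hcard : (Finset.univ.image fun i x => a i ⬝ᵥ b x).card ≤
      (Finset.univ : Finset (s → Bool)).card := by
    refine Finset.card_le_card_of_injOn (fun f v => decide (f (x v) = 1))
      (fun _ _ => Finset.mem_coe.2 (Finset.mem_univ _)) ?_
    intro f hf g hg hfg
    obtain ⟨i, -, rfl⟩ := Finset.mem_image.1 (Finset.mem_coe.1 hf)
    obtain ⟨j, -, rfl⟩ := Finset.mem_image.1 (Finset.mem_coe.1 hg)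
    refine funext (hdet i j fun v => ?_)
    have hv := congrFun hfg v
    simp only [decide_eq_decide, hx] at hv
    have h1 := h01 i (x v)
    have h2 := h01 j (x v)
    rw [hx] at h1 h2
    rcases h1 with h1 | h1 <;> rcases h2 with h2 | h2 <;> simp_all
  calc _ ≤ _ := hcard
    _ = 2 ^ Fintype.card s := by simp
    _ ≤ 2 ^ r := Nat.pow_le_pow_right two_pos hs

/-- Vectors with pairwise disjoint nonempty supports whose matrix factors through dimension `r`
number at most `r`. -/
theorem card_filter_ne_zero_le_of_disjoint {ι κ : Type*} [Fintype ι] {r : ℕ}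
    (a : ι → Fin r → ℂ) (b : κ → Fin r → ℂ) (p : ι → Prop) [DecidablePred p]
    (hp : ∀ i, p i → ∃ x, a i ⬝ᵥ b x ≠ 0)
    (hdisj : ∀ i j x, a i ⬝ᵥ b x ≠ 0 → a j ⬝ᵥ b x ≠ 0 → i = j) :
    (Finset.univ.filter p).card ≤ r := by
  have hli : LinearIndependent ℂ fun i : {i // p i} => a i := by
    rw [Fintype.linearIndependent_iff]
    intro c hc i
    obtain ⟨x, hx⟩ := hp i i.2
    have h0 : (∑ j, c j • a j) ⬝ᵥ b x = 0 := by simp [hc]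
    rw [sum_dotProduct, Finset.sum_eq_single i] at h0
    · simpa [hx] using h0
    · intro j _ hj
      have : a j ⬝ᵥ b x = 0 := by
        by_contra hne
        exact hj (Subtype.ext (hdisj _ _ x hne hx))
      simp [this]
    · simp
  rw [← Fintype.card_subtype]
  simpa using hli.fintype_card_le_finrank

/-- Grouping equal blocks of a partial permutation matrix of Schmidt rank at most `r` decomposes
it into at most `min {|α|², |α| r, 2^r}` products of partial permutation matrices. -/
theorem IsPartialPermMatrix.exists_kronecker_decomposition {α β : Type*} [Fintype α] {r : ℕ}
    {U : Matrix (α × β) (α × β) ℂ} (hU : IsPartialPermMatrix U)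
    (A : Fin r → Matrix α α ℂ) (B : Fin r → Matrix β β ℂ) (hAB : U = ∑ i, A i ⊗ₖ B i) :
    ∃ q : ℕ, q ≤ Fintype.card α ^ 2 ∧ q ≤ Fintype.card α * r ∧ q ≤ 2 ^ r ∧
      ∃ (A' : Fin q → Matrix α α ℂ) (B' : Fin q → Matrix β β ℂ),
        (∀ j, IsPartialPermMatrix (A' j)) ∧ (∀ j, IsPartialPermMatrix (B' j)) ∧
        U = ∑ j, A' j ⊗ₖ B' j := by
  classical
  obtain ⟨h01, hrow, hcol⟩ := hU
  let a : α × α → Fin r → ℂ := fun p i => A i p.1 p.2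
  let b : β × β → Fin r → ℂ := fun p i => B i p.1 p.2
  have hab : ∀ p x, a p ⬝ᵥ b x = U (p.1, x.1) (p.2, x.2) := by
    intro p x
    simp [hAB, Matrix.sum_apply, dotProduct, a, b]
  have hone : ∀ {x y}, U x y ≠ 0 → U x y = 1 := fun h => (h01 _ _).resolve_left h
  let F : α × α → β × β → ℂ := fun p x => a p ⬝ᵥ b x
  have hF : ∀ p x, F p x = U (p.1, x.1) (p.2, x.2) := hab
  have hF0 : ∀ {p}, F p ≠ 0 → ∃ x, F p x ≠ 0 := fun h => Function.ne_iff.1 h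
  let T : Finset (β × β → ℂ) := (Finset.univ.image F).erase 0
  have hT : ∀ {M}, M ∈ T → M ≠ 0 ∧ ∃ p, F p = M := by
    intro M hM
    simpa [T] using hM
  let e : Fin T.card ≃ T := T.equivFin.symm
  have hTsub : T.card ≤ (Finset.univ.image F).card := Finset.card_le_card (Finset.erase_subset _ _)
  refine ⟨T.card, ?_, ?_, ?_, fun j => of fun i i' => if F (i, i') = e j then 1 else 0,
    fun j => of fun k k' => (e j).1 (k, k'), ?_, ?_, ?_⟩
  · refine hTsub.trans (Finset.card_image_le.trans ?_)
    simp [sq]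
  · have hsub : T ⊆ Finset.univ.biUnion fun i =>
        (Finset.univ.filter fun i' => F (i, i') ≠ 0).image fun i' => F (i, i') := by
      intro M hM
      obtain ⟨h0, ⟨i, i'⟩, rfl⟩ := hT hM
      simp only [Finset.mem_biUnion, Finset.mem_univ, true_and, Finset.mem_image,
        Finset.mem_filter]
      exact ⟨i, i', h0, rfl⟩
    refine (Finset.card_le_card hsub).trans (Finset.card_biUnion_le_card_mul _ _ r fun i _ => ?_)
    refine Finset.card_image_le.trans
      (card_filter_ne_zero_le_of_disjoint (fun i' => a (i, i')) b _ (fun _ h => hF0 h) ?_)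
    intro i₁ i₂ x h₁ h₂
    rw [hab] at h₁ h₂
    exact congrArg Prod.fst (hrow _ _ _ (hone h₁) (hone h₂))
  · exact hTsub.trans (card_image_le_two_pow_of_zero_one a b fun p x => by
      rw [hab]; exact h01 _ _)
  · intro j
    have h0 := (hT (e j).2).1
    obtain ⟨x, hx⟩ := Function.ne_iff.1 h0
    have key : ∀ {i i'}, F (i, i') = e j → U (i, x.1) (i', x.2) = 1 := by
      intro i i' h
      refine hone ?_
      rw [← hF (i, i') x, h]
      exact hx
    refine ⟨fun i i' => ?_, fun i i₁ i₂ h₁ h₂ => ?_, fun i₁ i₂ i h₁ h₂ => ?_⟩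
    · simp only [of_apply]
      split_ifs <;> simp
    · simp only [of_apply, ite_eq_left_iff, zero_ne_one, imp_false, not_not] at h₁ h₂
      exact congrArg Prod.fst (hrow _ _ _ (key h₁) (key h₂))
    · simp only [of_apply, ite_eq_left_iff, zero_ne_one, imp_false, not_not] at h₁ h₂
      exact congrArg Prod.fst (hcol _ _ _ (key h₁) (key h₂))
  · intro j
    obtain ⟨-, p, hp⟩ := hT (e j).2
    simp only [← hp, hF, IsPartialPermMatrix, of_apply]
    exact ⟨fun _ _ => h01 _ _,
      fun _ _ _ h₁ h₂ => congrArg Prod.snd (hrow _ _ _ h₁ h₂),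
      fun _ _ _ h₁ h₂ => congrArg Prod.snd (hcol _ _ _ h₁ h₂)⟩
  · ext ⟨i, k⟩ ⟨i', k'⟩
    simp only [Matrix.sum_apply, kroneckerMap_apply, of_apply, ite_mul, one_mul, zero_mul]
    rw [e.sum_comp fun M : T => if F (i, i') = M then M.1 (k, k') else 0,
      Finset.sum_coe_sort T fun M => if F (i, i') = M then M (k, k') else 0,
      Finset.sum_ite_eq, ← hF (i, i') (k, k')]
    split_ifs with h
    · rfl
    · have : F (i, i') = 0 := by simpa [T] using h
      rw [this, Pi.zero_apply]

theorem IsPermMatrix.isPartialPermMatrix {n : Type*} {M : Matrix n n ℂ} (hM : IsPermMatrix M) :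
    IsPartialPermMatrix M :=
  ⟨hM.1, fun i _ _ h₁ h₂ => (hM.2.1 i).unique h₁ h₂, fun _ _ j h₁ h₂ => (hM.2.2 j).unique h₁ h₂⟩

theorem IsPartialPermMatrix.submatrix_equiv {m n : Type*} {M : Matrix n n ℂ}
    (hM : IsPartialPermMatrix M) (e : m ≃ n) : IsPartialPermMatrix (M.submatrix e e) :=
  ⟨fun _ _ => hM.1 _ _, fun _ _ _ h₁ h₂ => e.injective (hM.2.1 _ _ _ h₁ h₂),
    fun _ _ _ h₁ h₂ => e.injective (hM.2.2 _ _ _ h₁ h₂)⟩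

theorem Matrix.submatrix_prodComm_sum_kronecker {ι α β : Type*} [Fintype ι]
    (A : ι → Matrix α α ℂ) (B : ι → Matrix β β ℂ) :
    (∑ i, A i ⊗ₖ B i).submatrix (Equiv.prodComm β α) (Equiv.prodComm β α) =
      ∑ i, B i ⊗ₖ A i := by
  ext ⟨k, i⟩ ⟨k', i'⟩
  simp [Matrix.sum_apply, mul_comm]

/-- If a bipartite permutation matrix has Schmidt rank at most `r`, then its
partial-permutation rank is at most `min {d_A², d_B², d_A r, d_B r, 2^r}`. -/
theorem perm_partialPermRank (dA dB r : ℕ) (hdA : 1 ≤ dA) (hdB : 1 ≤ dB) (hr : 1 ≤ r)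
    (U : Matrix (Fin dA × Fin dB) (Fin dA × Fin dB) ℂ) (hU : IsPermMatrix U)
    (A : Fin r → Matrix (Fin dA) (Fin dA) ℂ) (B : Fin r → Matrix (Fin dB) (Fin dB) ℂ)
    (hAB : U = ∑ i, A i ⊗ₖ B i) :
    ∃ q : ℕ, q ≤ dA ^ 2 ∧ q ≤ dB ^ 2 ∧ q ≤ dA * r ∧ q ≤ dB * r ∧ q ≤ 2 ^ r ∧
      ∃ (A' : Fin q → Matrix (Fin dA) (Fin dA) ℂ)
        (B' : Fin q → Matrix (Fin dB) (Fin dB) ℂ),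
        (∀ j, IsPartialPermMatrix (A' j)) ∧ (∀ j, IsPartialPermMatrix (B' j)) ∧
        U = ∑ j, A' j ⊗ₖ B' j := by
  have hP := hU.isPartialPermMatrix
  obtain ⟨q₁, hq₁, hq₁r, hq₁2, A₁, B₁, hA₁, hB₁, hU₁⟩ :=
    hP.exists_kronecker_decomposition A B hAB
  obtain ⟨q₂, hq₂, hq₂r, hq₂2, B₂, A₂, hB₂, hA₂, hU₂⟩ :=
    (hP.submatrix_equiv (Equiv.prodComm _ _)).exists_kronecker_decomposition B A
      (by rw [hAB, submatrix_prodComm_sum_kronecker])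
  rw [Fintype.card_fin] at hq₁ hq₁r hq₂ hq₂r
  rcases le_total q₁ q₂ with h | h
  · exact ⟨q₁, hq₁, h.trans hq₂, hq₁r, h.trans hq₂r, hq₁2, A₁, B₁, hA₁, hB₁, hU₁⟩
  · refine ⟨q₂, h.trans hq₁, hq₂, h.trans hq₁r, hq₂r, hq₂2, A₂, B₂, hA₂, hB₂, ?_⟩
    rw [← submatrix_prodComm_sum_kronecker, ← hU₂]
    ext
    simp
end
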